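/- Let ψ ∈ T_n and let A = (A₁,…,Aₙ) be pairwise commuting generators of uniformly bounded C₀-semigroups on a complex Banach space X. Then ψ maps the joint residual spectrum of A into the residual spectrum of ψ(A): σ_R(ψ(A)) ⊇ ψ(σ_R(A)). -/

import Mathlib

open MeasureTheory Filter Topology

noncomputable section

/-- A (one-parameter) `C₀`-semigroup of bounded operators on `X`. -/
def IsC0Semigroup {X : Type*} [NormedAddCommGroup X] [NormedSpace ℂ X]
    (T : ℝ → X →L[ℂ] X) : Prop :=
  T 0 = 1 ∧ (∀ s t : ℝ, 0 ≤ s → 0 ≤ t → T (s + t) = T s ∘L T t) ∧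
    ∀ x : X, Tendsto (fun t => T t x) (𝓝[≥] (0 : ℝ)) (𝓝 x)

/-- `InGenDomain T x y` means `x` belongs to the domain of the infinitesimal generator `A`
of the semigroup `T` and `A x = y`. -/
def InGenDomain {X : Type*} [NormedAddCommGroup X] [NormedSpace ℂ X]
    (T : ℝ → X →L[ℂ] X) (x y : X) : Prop :=
  Tendsto (fun t : ℝ => t⁻¹ • (T t x - x)) (𝓝[>] (0 : ℝ)) (𝓝 y)

/-- The `n`-parameter semigroup `T(u) = T₁(u₁) ⋯ Tₙ(uₙ)`. -/
def Tprod {X : Type*} [NormedAddCommGroup X] [NormedSpace ℂ X] {n : ℕ}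
    (T : Fin n → ℝ → X →L[ℂ] X) (u : Fin n → ℝ) : X →L[ℂ] X :=
  (List.ofFn fun j => T j (u j)).prod

/-- The open negative orthant `(-∞,0)ⁿ`. -/
def negOrthant (n : ℕ) : Set (Fin n → ℝ) := {s | ∀ j, s j < 0}

/-- The closed nonpositive orthant `(-∞,0]ⁿ`. -/
def nonposOrthant (n : ℕ) : Set (Fin n → ℝ) := {s | ∀ j, s j ≤ 0}

/-- A function of `n` variables is absolutely monotone on `(-∞,0)ⁿ` if it is nonnegative
together with all its iterated partial derivatives there. -/
def AbsMonotoneOn (n : ℕ) (f : (Fin n → ℝ) → ℝ) : Prop :=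
  ∀ (k : ℕ) (v : Fin k → Fin n) (s : Fin n → ℝ), s ∈ negOrthant n →
    0 ≤ iteratedFDerivWithin ℝ k f (negOrthant n) s (fun i => Pi.single (v i) 1)

/-- Membership in the class `𝒯ₙ` of (negative) Bernstein functions of `n` variables:
`ψ` is a nonpositive `C^∞`-function on `(-∞,0)ⁿ` all of whose first-order partial
derivatives are absolutely monotone. -/
def MemTn (n : ℕ) (ψ : (Fin n → ℝ) → ℝ) : Prop :=
  ContDiffOn ℝ (⊤ : ℕ∞) ψ (negOrthant n) ∧ (∀ s ∈ negOrthant n, ψ s ≤ 0) ∧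
    ∀ j : Fin n, AbsMonotoneOn n
      (fun s => fderivWithin ℝ ψ (negOrthant n) s (Pi.single j 1))

/-- The Lévy–Khintchine type representation
`ψ(s) = c₀ + c₁·s + ∫ (e^{s·u} - 1) dμ(u)` of a Bernstein function of `n` variables,
where `c₀ ≤ 0`, `c₁ ∈ ℝ₊ⁿ` and `μ` is a positive measure on `ℝ₊ⁿ \ {0}`. -/
def HasLevyRep (n : ℕ) (ψ : (Fin n → ℝ) → ℝ) (c₀ : ℝ) (c₁ : Fin n → ℝ)
    (μ : Measure (Fin n → ℝ)) : Prop :=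
  c₀ ≤ 0 ∧ (∀ j, 0 ≤ c₁ j) ∧ μ {u | ¬ ((∀ j, 0 ≤ u j) ∧ u ≠ 0)} = 0 ∧
    (∀ s ∈ negOrthant n, Integrable (fun u => Real.exp (∑ j, s j * u j) - 1) μ) ∧
    ∀ s ∈ negOrthant n, ψ s = c₀ + ∑ j, c₁ j * s j +
      ∫ u, (Real.exp (∑ j, s j * u j) - 1) ∂μ

/-- The family of bounded positive measures `ν_t` on `ℝ₊ⁿ` with
`∫ e^{s·u} dν_t(u) = e^{t ψ(s)}` (multidimensional Bernstein–Widder). -/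
def IsSubordinator (n : ℕ) (ψ : (Fin n → ℝ) → ℝ) (ν : ℝ → Measure (Fin n → ℝ)) : Prop :=
  ∀ t : ℝ, 0 ≤ t → IsFiniteMeasure (ν t) ∧ (ν t) {u | ¬ ∀ j, 0 ≤ u j} = 0 ∧
    ∀ s ∈ negOrthant n, ∫ u, Real.exp (∑ j, s j * u j) ∂(ν t) = Real.exp (t * ψ s)

/-- The holomorphic (complex) extension `ψ(λ) = c₀ + c₁·λ + ∫ (e^{λ·u} - 1) dμ(u)`
of a Bernstein function with representation `(c₀, c₁, μ)` to `{Re λ ≤ 0} ⊆ ℂⁿ`. -/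
def psiC (n : ℕ) (c₀ : ℝ) (c₁ : Fin n → ℝ) (μ : Measure (Fin n → ℝ))
    (l : Fin n → ℂ) : ℂ :=
  (c₀ : ℂ) + ∑ j, (c₁ j : ℂ) * l j +
    ∫ u, (Complex.exp (∑ j, l j * (u j : ℂ)) - 1) ∂μ

/-- The joint point spectrum of the tuple of generators of the semigroups `T j`. -/
def JointPointSpectrum {X : Type*} [NormedAddCommGroup X] [NormedSpace ℂ X] {n : ℕ}
    (T : Fin n → ℝ → X →L[ℂ] X) : Set (Fin n → ℂ) :=
  {l | ∃ x : X, x ≠ 0 ∧ ∀ j, InGenDomain (T j) x (l j • x)}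

/-- The joint approximate point spectrum of the tuple of generators of the `T j`. -/
def JointApproxSpectrum {X : Type*} [NormedAddCommGroup X] [NormedSpace ℂ X] {n : ℕ}
    (T : Fin n → ℝ → X →L[ℂ] X) : Set (Fin n → ℂ) :=
  {l | ∃ (x : ℕ → X) (y : Fin n → ℕ → X), (∀ m, ‖x m‖ = 1) ∧
    (∀ j m, InGenDomain (T j) (x m) (y j m)) ∧
    ∀ j, Tendsto (fun m => ‖y j m - l j • x m‖) atTop (𝓝 0)}

/-- The joint residual spectrum of the tuple of generators of the `T j`:
those `λ ∈ ℂⁿ` for which `Σⱼ Im (λⱼ - Aⱼ)` is not dense in `X`. -/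
def JointResidualSpectrum {X : Type*} [NormedAddCommGroup X] [NormedSpace ℂ X] {n : ℕ}
    (T : Fin n → ℝ → X →L[ℂ] X) : Set (Fin n → ℂ) :=
  {l | ¬ Dense (↑(Submodule.span ℂ
      (⋃ j, {z : X | ∃ x y, InGenDomain (T j) x y ∧ z = l j • x - y})) : Set X)}

/-- The point spectrum of a (possibly unbounded) operator given by its graph
relation `R x y ↔ (x ∈ D(B) ∧ B x = y)`. -/
def PointSpec {X : Type*} [NormedAddCommGroup X] [NormedSpace ℂ X]
    (R : X → X → Prop) : Set ℂ :=
  {α | ∃ x : X, x ≠ 0 ∧ R x (α • x)}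

/-- The approximate point spectrum of an operator given by its graph relation. -/
def ApproxSpec {X : Type*} [NormedAddCommGroup X] [NormedSpace ℂ X]
    (R : X → X → Prop) : Set ℂ :=
  {α | ∃ x y : ℕ → X, (∀ m, ‖x m‖ = 1) ∧ (∀ m, R (x m) (y m)) ∧
    Tendsto (fun m => ‖y m - α • x m‖) atTop (𝓝 0)}

/-- The residual spectrum of an operator given by its graph relation:
those `α` for which `Im (α - B)` is not dense. -/
def ResidualSpec {X : Type*} [NormedAddCommGroup X] [NormedSpace ℂ X]
    (R : X → X → Prop) : Set ℂ :=
  {α | ¬ Dense (↑(Submodule.span ℂ {z : X | ∃ x y, R x y ∧ z = α • x - y}) : Set X)}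

/-- The resolvent set of a closed operator given by its graph relation: `α` such that
`α - B : D(B) → X` has a bounded everywhere-defined inverse. -/
def ResolventSet {X : Type*} [NormedAddCommGroup X] [NormedSpace ℂ X]
    (R : X → X → Prop) : Set ℂ :=
  {α | ∃ Rv : X →L[ℂ] X, (∀ z : X, R (Rv z) (α • Rv z - z)) ∧
    ∀ x y : X, R x y → Rv (α • x - y) = x}

/-- The constant `K_M = (M+1)/(1 - e^{-(M+1)/M})` from the moment inequality. -/
def KM (M : ℝ) : ℝ := (M + 1) / (1 - Real.exp (-(M + 1) / M))

/-- The open sector `{z ≠ 0 : |arg z| < θ}` in `ℂ`. -/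
def Sector (θ : ℝ) : Set ℂ := {z | z ≠ 0 ∧ |Complex.arg z| < θ}

/-- A `C₀`-semigroup is holomorphic if it extends to a holomorphic semigroup on some
open sector around the positive half axis, strongly continuous at `0` in the sector. -/
def IsHolomorphicSemigroup {X : Type*} [NormedAddCommGroup X] [NormedSpace ℂ X]
    (T : ℝ → X →L[ℂ] X) : Prop :=
  ∃ (θ : ℝ) (S : ℂ → X →L[ℂ] X), 0 < θ ∧ (∀ t : ℝ, 0 < t → S t = T t) ∧
    (∀ z w : ℂ, z ∈ Sector θ → w ∈ Sector θ → S (z + w) = S z ∘L S w) ∧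
    DifferentiableOn ℂ S (Sector θ) ∧
    ∀ x : X, Tendsto (fun z => S z x) (𝓝[Sector θ] 0) (𝓝 x)

end
theorem aux_functional {X : Type*} [NormedAddCommGroup X] [NormedSpace ℂ X]
    (S : Set X) (h : ¬ Dense (↑(Submodule.span ℂ S) : Set X)) :
    ∃ f : X →L[ℂ] ℂ, f ≠ 0 ∧ ∀ z ∈ S, f z = 0 := by
  set p := (Submodule.span ℂ S).topologicalClosure with hp
  have hne : p ≠ ⊤ := fun h' => h (Submodule.dense_iff_topologicalClosure_eq_top.2 h')
  obtain ⟨x, hx⟩ : ∃ x, x ∉ p := by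
    by_contra hcon
    push Not at hcon
    exact hne (eq_top_iff.2 fun x _ => hcon x)
  have hcl : IsClosed (p : Set X) := Submodule.isClosed_topologicalClosure _
  have : IsClosed (p : Set X) := hcl
  have hq : ‖(Submodule.Quotient.mk x : X ⧸ p)‖ ≠ 0 := by
    rw [norm_ne_zero_iff]
    intro h0
    exact hx ((Submodule.Quotient.mk_eq_zero p).1 h0)
  obtain ⟨f, hf1, hf2⟩ := exists_dual_vector ℂ (Submodule.Quotient.mk x : X ⧸ p) hq
  refine ⟨f ∘L p.mkQL, ?_, ?_⟩
  · intro h0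
    have : f (Submodule.Quotient.mk x) = 0 := by
      have := congrArg (fun F : X →L[ℂ] ℂ => F x) h0
      simpa using this
    rw [hf2] at this
    exact hq (Complex.ofReal_eq_zero.1 this)
  · intro z hz
    have hz' : z ∈ p := Submodule.le_topologicalClosure _ (Submodule.subset_span hz)
    have : (Submodule.Quotient.mk z : X ⧸ p) = 0 := (Submodule.Quotient.mk_eq_zero p).2 hz'
    show f (Submodule.Quotient.mk z) = 0
    rw [this, map_zero]

theorem aux_not_dense {X : Type*} [NormedAddCommGroup X] [NormedSpace ℂ X]
    (S : Set X) (f : X →L[ℂ] ℂ) (hf : f ≠ 0) (h : ∀ z ∈ S, f z = 0) :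
    ¬ Dense (↑(Submodule.span ℂ S) : Set X) := by
  intro hd
  apply hf
  have h1 : Submodule.span ℂ S ≤ f.toLinearMap.ker :=
    Submodule.span_le.2 fun z hz => by simpa using h z hz
  ext x
  have : Set.EqOn f (0 : X →L[ℂ] ℂ) (closure (Submodule.span ℂ S : Set X)) := by
    apply Set.EqOn.closure _ f.continuous (0 : X →L[ℂ] ℂ).continuous
    intro z hz
    have := h1 hz
    simpa using this
  exact this (hd x)

theorem aux_orbit {X : Type*} [NormedAddCommGroup X] [NormedSpace ℂ X]
    (T : ℝ → X →L[ℂ] X) (M : ℝ) (hT : IsC0Semigroup T) (hM : ∀ t, 0 ≤ t → ‖T t‖ ≤ M) (x : X) :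
    ContinuousOn (fun t => T t x) (Set.Ici 0) := by
  obtain ⟨h0, hadd, hc⟩ := hT
  have key : ∀ a b : ℝ, 0 ≤ a → 0 ≤ b → ‖T a x - T b x‖ ≤ M * ‖T |a - b| x - x‖ := by
    have base : ∀ a b : ℝ, 0 ≤ b → b ≤ a → ‖T a x - T b x‖ ≤ M * ‖T |a - b| x - x‖ := by
      intro a b hb hab
      have h1 : T a = T b ∘L T (a - b) := by
        rw [← hadd b (a - b) hb (by linarith)]; congr 1; ring
      rw [abs_of_nonneg (by linarith), h1, ContinuousLinearMap.comp_apply, ← map_sub]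
      exact (T b).le_of_opNorm_le (hM b hb) _
    intro a b ha hb
    rcases le_total b a with h | h
    · exact base a b hb h
    · rw [norm_sub_rev, abs_sub_comm]; exact base b a ha h
  intro b hb
  have hb : 0 ≤ b := hb
  rw [ContinuousWithinAt, tendsto_iff_norm_sub_tendsto_zero]
  have h1 : Tendsto (fun a : ℝ => |a - b|) (𝓝[Set.Ici 0] b) (𝓝[≥] 0) := by
    rw [tendsto_nhdsWithin_iff]
    refine ⟨?_, Eventually.of_forall fun a => Set.mem_Ici.2 (abs_nonneg _)⟩
    have : Tendsto (fun a : ℝ => |a - b|) (𝓝 b) (𝓝 |b - b|) :=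
      (by fun_prop : Continuous fun a : ℝ => |a - b|).tendsto b
    rw [sub_self, abs_zero] at this
    exact this.mono_left nhdsWithin_le_nhds
  have h2 : Tendsto (fun a : ℝ => M * ‖T |a - b| x - x‖) (𝓝[Set.Ici 0] b) (𝓝 0) := by
    have h3 := (tendsto_iff_norm_sub_tendsto_zero.1 ((hc x).comp h1)).const_mul M
    simpa using h3
  refine squeeze_zero' (Eventually.of_forall fun _ => norm_nonneg _) ?_ h2
  filter_upwards [self_mem_nhdsWithin] with a ha
  exact key a b ha hb

theorem aux_eigen {X : Type*} [NormedAddCommGroup X] [NormedSpace ℂ X] [CompleteSpace X]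
    (T : ℝ → X →L[ℂ] X) (M : ℝ) (hT : IsC0Semigroup T) (hM : ∀ t, 0 ≤ t → ‖T t‖ ≤ M)
    (f : X →L[ℂ] ℂ) (l : ℂ) (hf : ∀ x y, InGenDomain T x y → f (l • x - y) = 0)
    (x : X) (h : ℝ) (hh : 0 ≤ h) : f (T h x) = Complex.exp (l * h) * f x := by
  have horb := aux_orbit T M hT hM
  obtain ⟨h0, hadd, hc⟩ := hT
  set Φ : ℝ → X := fun t => T (max t 0) x with hΦ
  have hΦc : Continuous Φ :=
    (horb x).comp_continuous (by fun_prop) (fun t => Set.mem_Ici.2 (le_max_right _ _))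
  have hΦ' : ∀ t, 0 ≤ t → Φ t = T t x := fun t ht => by simp [hΦ, max_eq_left ht]
  have hint : ∀ a b, IntervalIntegrable Φ volume a b := fun a b => hΦc.intervalIntegrable a b
  have hder : ∀ b, HasDerivAt (fun t => ∫ s in (0:ℝ)..t, Φ s) (Φ b) b := fun b =>
    intervalIntegral.integral_hasDerivAt_right (hint _ _)
      (hΦc.stronglyMeasurableAtFilter _ _) hΦc.continuousAt
  -- domain
  have hdom : ∀ h, 0 ≤ h → InGenDomain T (∫ s in (0:ℝ)..h, Φ s) (T h x - x) := by
    intro h hh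
    have e1 : ∀ t, 0 ≤ t → T t (∫ s in (0:ℝ)..h, Φ s) = ∫ s in t..(h+t), Φ s := by
      intro t ht
      rw [← ContinuousLinearMap.intervalIntegral_comp_comm _ (hint _ _)]
      have : ∫ s in t..(h+t), Φ s = ∫ s in (0:ℝ)..h, Φ (s + t) := by
        rw [intervalIntegral.integral_comp_add_right]; simp
      rw [this]
      apply intervalIntegral.integral_congr
      intro s hs
      rw [Set.uIcc_of_le hh] at hs
      simp only
      rw [hΦ' s hs.1, hΦ' (s+t) (by linarith [hs.1]), add_comm s t, hadd t s ht hs.1]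
      rfl
    have e2 : ∀ t, 0 ≤ t → T t (∫ s in (0:ℝ)..h, Φ s) - (∫ s in (0:ℝ)..h, Φ s)
        = (∫ s in (0:ℝ)..(h+t), Φ s) - (∫ s in (0:ℝ)..h, Φ s) - ∫ s in (0:ℝ)..t, Φ s := by
      intro t ht
      rw [e1 t ht, ← intervalIntegral.integral_interval_sub_left (hint 0 (h+t)) (hint 0 t)]
      abel
    have d1 := (hasDerivAt_iff_tendsto_slope_zero.1 (hder h)).mono_left
      (nhdsWithin_mono (0:ℝ) (s := Set.Ioi 0) (fun t (ht : 0 < t) => ht.ne'))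
    have d2 := (hasDerivAt_iff_tendsto_slope_zero.1 (hder 0)).mono_left
      (nhdsWithin_mono (0:ℝ) (s := Set.Ioi 0) (fun t (ht : 0 < t) => ht.ne'))
    have d3 := d1.sub d2
    rw [hΦ' h hh, hΦ' 0 le_rfl, h0] at d3
    refine Tendsto.congr' ?_ d3
    filter_upwards [self_mem_nhdsWithin] with t ht
    rw [e2 t (le_of_lt ht)]
    simp [smul_sub]
  have hI : ∀ h, 0 ≤ h → f (T h x) = f x + l * f (∫ s in (0:ℝ)..h, Φ s) := by
    intro h hh
    have := hf _ _ (hdom h hh)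
    rw [map_sub, map_sub, map_smul, smul_eq_mul] at this
    linear_combination -this
  set I : ℝ → ℂ := fun t => f (∫ s in (0:ℝ)..t, Φ s) with hIdef
  have hId : ∀ b, HasDerivAt I (f (Φ b)) b := fun b => 
    (f.restrictScalars ℝ).hasFDerivAt.comp_hasDerivAt b (hder b)
  have hq : ∀ b : ℝ, HasDerivAt (fun t : ℝ => Complex.exp (-l * t) * (f x + l * I t))
      (Complex.exp (-l * b) * (-l) * (f x + l * I b) + Complex.exp (-l * b) * (l * f (Φ b))) b := by
    intro b
    have e : HasDerivAt (fun t : ℝ => Complex.exp (-l * t)) (Complex.exp (-l * b) * (-l)) b := by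
      have : HasDerivAt (fun t : ℂ => Complex.exp (-l * t)) (Complex.exp (-l * b) * (-l)) (b : ℂ) := by
        simpa using ((hasDerivAt_id (b : ℂ)).const_mul (-l)).cexp
      exact this.comp_ofReal
    exact e.mul (((hId b).const_mul l).const_add (f x))
  have hconst := constant_of_has_deriv_right_zero (a := 0) (b := h)
    (f := fun t : ℝ => Complex.exp (-l * t) * (f x + l * I t))
    (fun t _ => (hq t).continuousAt.continuousWithinAt) (by
      intro t ht
      have := (hq t).hasDerivWithinAt (s := Set.Ici t)
      convert this using 1
      rw [hΦ' t ht.1, hI t ht.1]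
      ring) h ⟨hh, le_rfl⟩
  have I0 : I 0 = 0 := by simp [hIdef]
  simp only [I0] at hconst
  rw [hI h hh]
  have e2 : Complex.exp (l * h) * Complex.exp (-l * h) = 1 := by
    rw [← Complex.exp_add]; simp
  have : f x + l * I h = Complex.exp (l * h) * (Complex.exp (-l * h) * (f x + l * I h)) := by
    rw [← mul_assoc, e2, one_mul]
  rw [this, hconst]; simp

theorem aux_re {X : Type*} [NormedAddCommGroup X] [NormedSpace ℂ X]
    (T : ℝ → X →L[ℂ] X) (M : ℝ) (hM : ∀ t, 0 ≤ t → ‖T t‖ ≤ M)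
    (f : X →L[ℂ] ℂ) (l : ℂ) (x : X) (hx : f x ≠ 0)
    (hf : ∀ h : ℝ, 0 ≤ h → f (T h x) = Complex.exp (l * h) * f x) : l.re ≤ 0 := by
  by_contra hcon
  push Not at hcon
  have hb : ∀ t : ℝ, 0 ≤ t → Real.exp (l.re * t) * ‖f x‖ ≤ ‖f‖ * (M * ‖x‖) := by
    intro t ht
    have h1 : ‖f (T t x)‖ ≤ ‖f‖ * (M * ‖x‖) :=
      (f.le_opNorm _).trans (by gcongr; exact (T t).le_of_opNorm_le (hM t ht) x)
    rw [hf t ht, norm_mul, Complex.norm_exp] at h1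
    simpa using h1
  have hpos : 0 < ‖f x‖ := norm_pos_iff.2 hx
  have ht : Tendsto (fun t : ℝ => Real.exp (l.re * t) * ‖f x‖) atTop atTop :=
    (Real.tendsto_exp_atTop.comp (tendsto_id.const_mul_atTop hcon)).atTop_mul_const hpos
  obtain ⟨t, ht1, ht2⟩ := ((ht.eventually_gt_atTop (‖f‖ * (M * ‖x‖))).and
    (eventually_ge_atTop 0)).exists
  exact absurd (hb t ht2) (not_le.2 ht1)

theorem aux_Tprod_succ {X : Type*} [NormedAddCommGroup X] [NormedSpace ℂ X] {n : ℕ}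
    (T : Fin (n+1) → ℝ → X →L[ℂ] X) (u : Fin (n+1) → ℝ) (x : X) :
    Tprod T u x = T 0 (u 0) (Tprod (fun j => T j.succ) (fun j => u j.succ) x) := by
  simp [Tprod, List.ofFn_succ]

theorem aux_Tprod_cont {X : Type*} [NormedAddCommGroup X] [NormedSpace ℂ X] {n : ℕ}
    (T : Fin n → ℝ → X →L[ℂ] X) (M : Fin n → ℝ)
    (hT : ∀ j, IsC0Semigroup (T j)) (hM : ∀ j t, 0 ≤ t → ‖T j t‖ ≤ M j) (x : X) :
    ContinuousOn (fun u => Tprod T u x) {u : Fin n → ℝ | ∀ j, 0 ≤ u j} := by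
  induction n with
  | zero => simp only [Tprod, List.ofFn_zero, List.prod_nil]; exact continuousOn_const
  | succ n ih =>
    have ih' := ih (fun j => T j.succ) (fun j => M j.succ) (fun j => hT _) (fun j => hM _)
    simp only [aux_Tprod_succ]
    set v : (Fin (n+1) → ℝ) → X :=
      fun u => Tprod (fun j => T j.succ) (fun j => u j.succ) x with hv
    have hvc : ContinuousOn v {u : Fin (n+1) → ℝ | ∀ j, 0 ≤ u j} :=
      ih'.comp (by fun_prop) (fun u hu j => hu j.succ)
    intro a ha
    have h1 : Tendsto (fun u : Fin (n+1) → ℝ => T 0 (u 0) (v a))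
        (𝓝[{u | ∀ j, 0 ≤ u j}] a) (𝓝 (T 0 (a 0) (v a))) := by
      have hp : ContinuousOn (fun u : Fin (n+1) → ℝ => u 0) {u | ∀ j, 0 ≤ u j} := by fun_prop
      have := (aux_orbit (T 0) (M 0) (hT 0) (hM 0) (v a)).comp hp (fun u hu => hu 0)
      exact this a ha
    have h2 : Tendsto (fun u : Fin (n+1) → ℝ => T 0 (u 0) (v u - v a))
        (𝓝[{u | ∀ j, 0 ≤ u j}] a) (𝓝 0) := by
      have h3 := (tendsto_iff_norm_sub_tendsto_zero.1 (hvc a ha)).const_mul (M 0)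
      rw [mul_zero] at h3
      refine squeeze_zero_norm' ?_ h3
      filter_upwards [self_mem_nhdsWithin] with u hu
      exact (T 0 (u 0)).le_of_opNorm_le (hM 0 _ (hu 0)) _
    have h3 := h1.add h2
    simpa [ContinuousWithinAt] using h3

theorem aux_Tprod_bd {X : Type*} [NormedAddCommGroup X] [NormedSpace ℂ X] {n : ℕ}
    (T : Fin n → ℝ → X →L[ℂ] X) (M : Fin n → ℝ)
    (hM : ∀ j t, 0 ≤ t → ‖T j t‖ ≤ M j) (x : X) :
    ∃ C, ∀ u : Fin n → ℝ, (∀ j, 0 ≤ u j) → ‖Tprod T u x‖ ≤ C := by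
  induction n with
  | zero => exact ⟨‖x‖, fun u _ => by simp [Tprod]⟩
  | succ n ih =>
    obtain ⟨C, hC⟩ := ih (fun j => T j.succ) (fun j => M j.succ) (fun j => hM _)
    refine ⟨M 0 * C, fun u hu => ?_⟩
    rw [aux_Tprod_succ]
    have h0 : 0 ≤ M 0 := (norm_nonneg _).trans (hM 0 0 le_rfl)
    exact ((T 0 (u 0)).le_of_opNorm_le (hM 0 _ (hu 0)) _).trans
      (mul_le_mul_of_nonneg_left (hC _ fun j => hu j.succ) h0)

theorem aux_Tprod_eig {X : Type*} [NormedAddCommGroup X] [NormedSpace ℂ X] {n : ℕ}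
    (T : Fin n → ℝ → X →L[ℂ] X) (f : X →L[ℂ] ℂ) (l : Fin n → ℂ)
    (hf : ∀ j (x : X) (h : ℝ), 0 ≤ h → f (T j h x) = Complex.exp (l j * h) * f x) (x : X)
    (u : Fin n → ℝ) (hu : ∀ j, 0 ≤ u j) :
    f (Tprod T u x) = Complex.exp (∑ j, l j * (u j : ℂ)) * f x := by
  induction n with
  | zero => simp [Tprod]
  | succ n ih =>
    rw [aux_Tprod_succ, hf 0 _ _ (hu 0),
      ih (fun j => T j.succ) (fun j => l j.succ) (fun j => hf _) _ (fun j => hu _),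
      Fin.sum_univ_succ, Complex.exp_add, mul_assoc]

theorem aux_exp_bd (S : ℝ) (hS : 0 ≤ S) : S ≤ (1 + S) * (1 - Real.exp (-S)) := by
  have h1 : S + 1 ≤ Real.exp S := Real.add_one_le_exp S
  have h2 : Real.exp (-S) * Real.exp S = 1 := by rw [← Real.exp_add]; simp
  have h3 : (1 + S) * Real.exp (-S) ≤ 1 := by
    rw [← h2, mul_comm]
    exact mul_le_mul_of_nonneg_left (by linarith) (Real.exp_pos _).le
  nlinarith

theorem aux_cexp_bd (w : ℂ) (S L : ℝ) (hS : 0 ≤ S) (hw : w.re ≤ 0)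
    (hwL : ‖w‖ ≤ L * S) : ‖Complex.exp w - 1‖ ≤ (2 + 2 * L) * (1 - Real.exp (-S)) := by
  have hE : ‖Complex.exp w‖ ≤ 1 := by rw [Complex.norm_exp]; exact Real.exp_le_one_iff.2 hw
  have h2 : ‖Complex.exp w - 1‖ ≤ 2 := by
    refine (norm_sub_le _ _).trans ?_
    rw [norm_one]; linarith
  have h1 : ‖Complex.exp w - 1‖ ≤ 2 * (L * S) := by
    rcases le_total ‖w‖ 1 with h | h
    · exact (Complex.norm_exp_sub_one_le h).trans (by linarith)
    · linarith
  have h3 := aux_exp_bd S hS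
  have h0 := norm_nonneg (Complex.exp w - 1)
  have hE1 : 0 ≤ 1 - Real.exp (-S) := by
    have : Real.exp (-S) ≤ 1 := Real.exp_le_one_iff.2 (by linarith)
    linarith
  have h4 : (1 + S) * ‖Complex.exp w - 1‖ ≤ (2 + 2 * L) * S := by nlinarith
  by_cases hL : 0 ≤ 2 + 2 * L
  · have h5 : (1 + S) * ‖Complex.exp w - 1‖ ≤ (1 + S) * ((2 + 2 * L) * (1 - Real.exp (-S))) := by
      nlinarith [mul_le_mul_of_nonneg_left h3 hL]
    exact le_of_mul_le_mul_left h5 (by linarith)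
  · have hS0 : S = 0 := by
      by_contra hne
      have : 0 < S := lt_of_le_of_ne hS (Ne.symm hne)
      nlinarith [norm_nonneg w]
    subst hS0
    have : ‖Complex.exp w - 1‖ ≤ 0 := by simpa using h1
    simpa using this

theorem aux_sexp_bd (S δ : ℝ) (hS : 0 ≤ S) (hδ : 0 < δ) :
    S * Real.exp (-(δ * S)) ≤ (1 + 1 / δ) * (1 - Real.exp (-S)) := by
  have h3 := aux_exp_bd S hS
  have hE1 : 0 ≤ 1 - Real.exp (-S) := by
    have : Real.exp (-S) ≤ 1 := Real.exp_le_one_iff.2 (by linarith)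
    linarith
  have h1 : δ * S + 1 ≤ Real.exp (δ * S) := Real.add_one_le_exp _
  have h2 : Real.exp (-(δ * S)) * Real.exp (δ * S) = 1 := by rw [← Real.exp_add]; simp
  have h4 : 1 + S ≤ (1 + 1 / δ) * Real.exp (δ * S) := by
    have e : (1 + 1 / δ) * (δ * S + 1) = 1 + S + (δ * S + 1 / δ) := by field_simp; ring
    have : (1 + 1 / δ) * (δ * S + 1) ≤ (1 + 1 / δ) * Real.exp (δ * S) := by gcongr
    have : 0 ≤ δ * S + 1 / δ := by positivity
    linarith
  have h5 : (1 + S) * Real.exp (-(δ * S)) ≤ 1 + 1 / δ := by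
    calc (1 + S) * Real.exp (-(δ * S))
        ≤ (1 + 1 / δ) * Real.exp (δ * S) * Real.exp (-(δ * S)) := by gcongr
      _ = 1 + 1 / δ := by rw [mul_assoc, mul_comm (Real.exp (δ * S)), h2, mul_one]
  calc S * Real.exp (-(δ * S)) ≤ (1 + S) * (1 - Real.exp (-S)) * Real.exp (-(δ * S)) := by gcongr
    _ = (1 + S) * Real.exp (-(δ * S)) * (1 - Real.exp (-S)) := by ring
    _ ≤ _ := by gcongr

theorem aux_sum_norm {n : ℕ} (l : Fin n → ℂ) (u : Fin n → ℝ) (hu : ∀ j, 0 ≤ u j) :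
    ‖∑ j, l j * (u j : ℂ)‖ ≤ (∑ j, ‖l j‖) * ∑ j, u j := by
  refine (norm_sum_le _ _).trans ?_
  rw [Finset.sum_mul]
  refine Finset.sum_le_sum fun j _ => ?_
  rw [norm_mul, Complex.norm_real, Real.norm_of_nonneg (hu j)]
  exact mul_le_mul_of_nonneg_left
    (Finset.single_le_sum (f := u) (fun i _ => hu i) (Finset.mem_univ j)) (norm_nonneg _)

theorem aux_sum_re {n : ℕ} (l : Fin n → ℂ) (u : Fin n → ℝ) :
    (∑ j, l j * (u j : ℂ)).re = ∑ j, (l j).re * u j := by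
  simp [Complex.re_sum]

theorem aux_bd {n : ℕ} (l : Fin n → ℂ) (hl : ∀ j, (l j).re ≤ 0) (L : ℝ) (hL : ∑ j, ‖l j‖ ≤ L)
    (u : Fin n → ℝ) (hu : ∀ j, 0 ≤ u j) :
    ‖Complex.exp (∑ j, l j * (u j : ℂ)) - 1‖ ≤ (2 + 2 * L) * (1 - Real.exp (-∑ j, u j)) := by
  have hS : 0 ≤ ∑ j, u j := Finset.sum_nonneg fun j _ => hu j
  apply aux_cexp_bd _ _ _ hS
  · rw [aux_sum_re]
    exact Finset.sum_nonpos fun j _ => mul_nonpos_of_nonpos_of_nonneg (hl j) (hu j)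
  · exact (aux_sum_norm l u hu).trans (by gcongr)

theorem aux_meas {n : ℕ} (m : Measure (Fin n → ℝ)) (l : Fin n → ℂ) :
    AEStronglyMeasurable (fun u : Fin n → ℝ => Complex.exp (∑ j, l j * (u j : ℂ)) - 1) m :=
  (by fun_prop : Continuous fun u : Fin n → ℝ =>
    Complex.exp (∑ j, l j * (u j : ℂ)) - 1).aestronglyMeasurable

theorem aux_integrable {n : ℕ} (m : Measure (Fin n → ℝ)) (hm0 : ∀ᵐ u ∂m, ∀ j, 0 ≤ u j)
    (hmi : Integrable (fun u : Fin n → ℝ => 1 - Real.exp (-∑ j, u j)) m)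
    (l : Fin n → ℂ) (hl : ∀ j, (l j).re ≤ 0) :
    Integrable (fun u : Fin n → ℝ => Complex.exp (∑ j, l j * (u j : ℂ)) - 1) m := by
  refine (hmi.const_mul (2 + 2 * ∑ j, ‖l j‖)).mono' (aux_meas m l) ?_
  filter_upwards [hm0] with u hu
  exact aux_bd l hl _ le_rfl u hu

theorem aux_diff {n : ℕ} (m : Measure (Fin n → ℝ)) (hm0 : ∀ᵐ u ∂m, ∀ j, 0 ≤ u j)
    (hmi : Integrable (fun u : Fin n → ℝ => 1 - Real.exp (-∑ j, u j)) m)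
    (a b : Fin n → ℝ) (z₀ : ℂ) (hz : ∀ j, a j + z₀.re * b j < 0) :
    DifferentiableAt ℂ
      (fun z : ℂ => ∫ u, (Complex.exp (∑ j, ((a j : ℂ) + z * b j) * (u j : ℂ)) - 1) ∂m) z₀ := by
  obtain ⟨δ, hδz, hδ⟩ : ∃ δ : ℝ, (∀ j, a j + z₀.re * b j < -δ) ∧ 0 < δ := by
    have h1 : ∀ᶠ δ in 𝓝[>] (0:ℝ), ∀ j, a j + z₀.re * b j < -δ := by
      rw [eventually_all]
      intro j
      have : Tendsto (fun δ : ℝ => -δ) (𝓝[>] 0) (𝓝 (-0)) :=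
        (continuous_neg.tendsto 0).mono_left nhdsWithin_le_nhds
      rw [neg_zero] at this
      exact this.eventually (lt_mem_nhds (hz j))
    exact (h1.and self_mem_nhdsWithin).exists
  set s : Set ℂ := {z | ∀ j, a j + z.re * b j < -δ} with hs
  have hso : IsOpen s := by
    rw [hs, Set.ofPred_forall]
    exact isOpen_iInter_of_finite fun j => isOpen_lt (by fun_prop) continuous_const
  have hre : ∀ z : ℂ, ∀ j, ((a j : ℂ) + z * b j).re = a j + z.re * b j := by
    intro z j; simp
  have key := hasDerivAt_integral_of_dominated_loc_of_deriv_le (μ := m) (𝕜 := ℂ) (x₀ := z₀) (s := s)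
    (F := fun z u => Complex.exp (∑ j, ((a j : ℂ) + z * b j) * (u j : ℂ)) - 1)
    (F' := fun z u => Complex.exp (∑ j, ((a j : ℂ) + z * b j) * (u j : ℂ)) *
      ∑ j, (b j : ℂ) * (u j : ℂ))
    (bound := fun u => (∑ j, ‖(b j : ℂ)‖) * ((1 + 1 / δ) * (1 - Real.exp (-∑ j, u j))))
    (hso.mem_nhds hδz) (Eventually.of_forall fun z => aux_meas m _)
    (aux_integrable m hm0 hmi _ fun j => by rw [hre]; exact (hz j).le)
    ((by fun_prop : Continuous fun u : Fin n → ℝ =>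
      Complex.exp (∑ j, ((a j : ℂ) + z₀ * b j) * (u j : ℂ)) *
      ∑ j, (b j : ℂ) * (u j : ℂ)).aestronglyMeasurable)
    (by
      filter_upwards [hm0] with u hu z hzs
      have hS : 0 ≤ ∑ j, u j := Finset.sum_nonneg fun j _ => hu j
      rw [norm_mul, Complex.norm_exp, aux_sum_re]
      have h1 : Real.exp (∑ j, ((a j : ℂ) + z * b j).re * u j) ≤ Real.exp (-(δ * ∑ j, u j)) := by
        apply Real.exp_le_exp.2
        rw [← neg_mul, Finset.mul_sum]
        refine Finset.sum_le_sum fun j _ => ?_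
        rw [hre]
        exact mul_le_mul_of_nonneg_right (hzs j).le (hu j)
      have h2 := aux_sum_norm (fun j => (b j : ℂ)) u hu
      have h3 := aux_sexp_bd _ δ hS hδ
      have hB : 0 ≤ ∑ j, ‖(b j : ℂ)‖ := Finset.sum_nonneg fun j _ => norm_nonneg _
      calc _ ≤ Real.exp (-(δ * ∑ j, u j)) * ((∑ j, ‖(b j : ℂ)‖) * ∑ j, u j) := by gcongr
        _ = (∑ j, ‖(b j : ℂ)‖) * ((∑ j, u j) * Real.exp (-(δ * ∑ j, u j))) := by ring
        _ ≤ _ := by gcongr)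
    ((hmi.const_mul _).const_mul _)
    (by
      refine Eventually.of_forall fun u z _ => ?_
      have h1 : HasDerivAt (fun z : ℂ => ∑ j, ((a j : ℂ) + z * b j) * (u j : ℂ))
          (∑ j, (b j : ℂ) * (u j : ℂ)) z := by
        refine HasDerivAt.fun_sum fun j _ => ?_
        simpa using (((hasDerivAt_id z).mul_const (b j : ℂ)).const_add (a j : ℂ)).mul_const (u j : ℂ)
      exact h1.cexp.sub_const 1)
  exact key.2.differentiableAt

theorem aux_lim {n : ℕ} (m : Measure (Fin n → ℝ)) (hm0 : ∀ᵐ u ∂m, ∀ j, 0 ≤ u j)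
    (hmi : Integrable (fun u : Fin n → ℝ => 1 - Real.exp (-∑ j, u j)) m)
    (l : Fin n → ℂ) (hl : ∀ j, (l j).re ≤ 0) :
    Tendsto (fun ε : ℝ => ∫ u, (Complex.exp (∑ j, (l j - (ε : ℂ)) * (u j : ℂ)) - 1) ∂m)
      (𝓝[>] 0) (𝓝 (∫ u, (Complex.exp (∑ j, l j * (u j : ℂ)) - 1) ∂m)) := by
  refine tendsto_integral_filter_of_dominated_convergence
    (fun u => (2 + 2 * ∑ j, (‖l j‖ + 1)) * (1 - Real.exp (-∑ j, u j)))
    (Eventually.of_forall fun ε => aux_meas m _) ?_ (hmi.const_mul _) ?_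
  · have h1 : ∀ᶠ ε in 𝓝[>] (0:ℝ), ε < 1 := nhdsWithin_le_nhds (gt_mem_nhds one_pos)
    filter_upwards [h1, self_mem_nhdsWithin] with ε h1 (h2 : 0 < ε)
    filter_upwards [hm0] with u hu
    refine aux_bd (fun j => l j - (ε : ℂ)) (fun j => ?_) _ ?_ u hu
    · have := hl j
      simp; linarith
    · refine Finset.sum_le_sum fun j _ => (norm_sub_le _ _).trans ?_
      rw [Complex.norm_real, Real.norm_of_nonneg h2.le]
      linarith
  · refine Eventually.of_forall fun u => ?_
    have : Continuous fun ε : ℝ => Complex.exp (∑ j, (l j - (ε : ℂ)) * (u j : ℂ)) - 1 := by fun_prop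
    have h := (this.tendsto 0).mono_left (nhdsWithin_le_nhds (s := Set.Ioi 0))
    simpa using h

/-- Analytic continuation of the Laplace transform identity. -/
theorem aux_laplace {n : ℕ} (ψ : (Fin n → ℝ) → ℝ) (c₀ : ℝ) (c₁ : Fin n → ℝ)
    (μ ν : Measure (Fin n → ℝ)) (hrep : HasLevyRep n ψ c₀ c₁ μ) (t : ℝ)
    [IsFiniteMeasure ν] (hν0 : ν {u | ¬ ∀ j, 0 ≤ u j} = 0)
    (hν : ∀ s ∈ negOrthant n, ∫ u, Real.exp (∑ j, s j * u j) ∂ν = Real.exp (t * ψ s))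
    (l : Fin n → ℂ) (hl : ∀ j, (l j).re ≤ 0) :
    ∫ u, Complex.exp (∑ j, l j * (u j : ℂ)) ∂ν = Complex.exp (t * psiC n c₀ c₁ μ l) := by
  obtain ⟨-, -, hμ0, hμi, hψ⟩ := hrep
  have hν0' : ∀ᵐ u ∂ν, ∀ j, 0 ≤ u j := hν0
  have hμ0' : ∀ᵐ u ∂μ, ∀ j, 0 ≤ u j := by
    have : ∀ᵐ u ∂μ, (∀ j, 0 ≤ u j) ∧ u ≠ 0 := hμ0
    exact this.mono fun u h => h.1
  have hμi' : Integrable (fun u : Fin n → ℝ => 1 - Real.exp (-∑ j, u j)) μ := by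
    have := (hμi (fun _ => -1) (fun j => by norm_num)).neg
    refine this.congr (Eventually.of_forall fun u => ?_)
    simp
  have hνi' : Integrable (fun u : Fin n → ℝ => 1 - Real.exp (-∑ j, u j)) ν := by
    refine (integrable_const (1:ℝ)).mono' (Continuous.aestronglyMeasurable (by fun_prop)) ?_
    filter_upwards [hν0'] with u hu
    have hS : 0 ≤ ∑ j, u j := Finset.sum_nonneg fun j _ => hu j
    have : Real.exp (-∑ j, u j) ≤ 1 := Real.exp_le_one_iff.2 (by linarith)
    rw [Real.norm_of_nonneg (by linarith)]
    linarith [Real.exp_pos (-∑ j, u j)]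
  set V : ℂ := ((ν.real Set.univ : ℝ) : ℂ) with hV
  set F : (Fin n → ℂ) → ℂ := fun l => (∫ u, (Complex.exp (∑ j, l j * (u j : ℂ)) - 1) ∂ν) + V with hF
  have hFe : ∀ l : Fin n → ℂ, (∀ j, (l j).re ≤ 0) →
      ∫ u, Complex.exp (∑ j, l j * (u j : ℂ)) ∂ν = F l := by
    intro l hl
    have h1 := aux_integrable ν hν0' hνi' l hl
    have h2 := integral_add h1 (integrable_const (1:ℂ))
    simpa [hF, hV] using h2
  set G : (Fin n → ℂ) → ℂ := fun l => Complex.exp (t * psiC n c₀ c₁ μ l) with hG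
  have hreal : ∀ s ∈ negOrthant n, F (fun j => (s j : ℂ)) = G (fun j => (s j : ℂ)) := by
    intro s hs
    rw [← hFe _ (fun j => by simpa using (hs j).le)]
    have e1 : ∫ u, Complex.exp (∑ j, (s j : ℂ) * (u j : ℂ)) ∂ν
        = ((∫ u, Real.exp (∑ j, s j * u j) ∂ν : ℝ) : ℂ) := by
      rw [← integral_complex_ofReal]; congr 1; ext u; push_cast; rfl
    have e2 : psiC n c₀ c₁ μ (fun j => (s j : ℂ)) = (ψ s : ℂ) := by
      rw [hψ s hs, psiC]
      push_cast
      rw [← integral_complex_ofReal]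
      congr 2; ext u; push_cast; rfl
    rw [e1, hν s hs, hG]
    simp only [e2]
    push_cast; rfl
  have hint : ∀ l : Fin n → ℂ, (∀ j, (l j).re < 0) → F l = G l := by
    intro l hl
    set a : Fin n → ℝ := fun j => (l j).re with ha
    set b : Fin n → ℝ := fun j => (l j).im with hb
    set U : Set ℂ := {z | ∀ j, a j + z.re * b j < 0} with hU
    have hUo : IsOpen U := by
      rw [hU, Set.ofPred_forall]
      exact isOpen_iInter_of_finite fun j => isOpen_lt (by fun_prop) continuous_const
    have hUc : Convex ℝ U := by
      intro z hz w hw p q hp hq hpq j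
      have h1 := hz j
      have h2 := hw j
      have e : a j + (p • z + q • w).re * b j
          = p * (a j + z.re * b j) + q * (a j + w.re * b j) := by
        simp
        linear_combination (-a j) * hpq
      rw [e]
      rcases hp.eq_or_lt with h | h
      · have : q = 1 := by linarith
        subst h; subst this; linarith
      · have := mul_neg_of_pos_of_neg h h1
        have := mul_nonpos_of_nonneg_of_nonpos hq h2.le
        linarith
    have hFd : DifferentiableOn ℂ (fun z : ℂ => F fun j => (a j : ℂ) + z * b j) U := fun z hz =>
      ((aux_diff ν hν0' hνi' a b z hz).add_const V).differentiableWithinAt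
    have hGd : DifferentiableOn ℂ (fun z : ℂ => G fun j => (a j : ℂ) + z * b j) U := by
      intro z hz
      have h1 := aux_diff μ hμ0' hμi' a b z hz
      have h2 : DifferentiableAt ℂ (fun z : ℂ => (c₀ : ℂ) +
          ∑ j, (c₁ j : ℂ) * ((a j : ℂ) + z * b j)) z := by fun_prop
      exact (((h2.add h1).const_mul (t : ℂ)).cexp).differentiableWithinAt
    have h0U : (0 : ℂ) ∈ U := fun j => by simpa [ha] using hl j
    have hfreq : ∃ᶠ z in 𝓝[≠] (0:ℂ), (F fun j => (a j : ℂ) + z * b j)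
        = G fun j => (a j : ℂ) + z * b j := by
      have htend : Tendsto (fun r : ℝ => (r : ℂ)) (𝓝[≠] 0) (𝓝[≠] 0) := by
        refine tendsto_nhdsWithin_iff.2 ⟨?_, ?_⟩
        · have := (Complex.continuous_ofReal.tendsto 0).mono_left
            (nhdsWithin_le_nhds (s := {(0:ℝ)}ᶜ))
          simpa using this
        · filter_upwards [self_mem_nhdsWithin] with r hr
          simpa using hr
      refine htend.frequently ?_
      apply Eventually.frequently
      have hUe : ∀ᶠ r : ℝ in 𝓝[≠] 0, (r : ℂ) ∈ U :=
        htend (mem_nhdsWithin_of_mem_nhds (hUo.mem_nhds h0U))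
      filter_upwards [hUe] with r hr
      have := hreal (fun j => a j + r * b j) (fun j => by simpa using hr j)
      simpa using this
    have := (hFd.analyticOnNhd hUo).eqOn_of_preconnected_of_frequently_eq
      (hGd.analyticOnNhd hUo) hUc.isPreconnected h0U hfreq
    have hI : Complex.I ∈ U := fun j => by simpa [ha] using hl j
    have h := this hI
    have e : (fun j => (a j : ℂ) + Complex.I * b j) = l := by
      ext j; rw [mul_comm]; exact Complex.re_add_im (l j)
    simpa only [e] using h
  rw [hFe l hl]
  have hF1 : Tendsto (fun ε : ℝ => F fun j => l j - (ε : ℂ)) (𝓝[>] 0) (𝓝 (F l)) :=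
    (aux_lim ν hν0' hνi' l hl).add_const V
  have hG1 : Tendsto (fun ε : ℝ => G fun j => l j - (ε : ℂ)) (𝓝[>] 0) (𝓝 (G l)) := by
    have h1 := aux_lim μ hμ0' hμi' l hl
    have hc : Continuous fun ε : ℝ => (c₀ : ℂ) + ∑ j, (c₁ j : ℂ) * (l j - (ε : ℂ)) := by fun_prop
    have h2 := (hc.tendsto 0).mono_left (nhdsWithin_le_nhds (s := Set.Ioi 0))
    simp only [Complex.ofReal_zero, sub_zero] at h2
    exact ((Complex.continuous_exp.tendsto _).comp ((h2.add h1).const_mul (t : ℂ)))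
  refine tendsto_nhds_unique (hF1.congr' ?_) hG1
  filter_upwards [self_mem_nhdsWithin] with ε (hε : 0 < ε)
  refine hint _ fun j => ?_
  have := hl j
  simp; linarith

/-- For `ψ ∈ 𝒯ₙ` and pairwise commuting generators `A` of uniformly
bounded `C₀`-semigroups, `ψ` maps the joint residual spectrum of `A` into the residual
spectrum of `ψ(A)` (the generator of the subordinated semigroup `g(A)`):
`σ_R(ψ(A)) ⊇ ψ(σ_R(A))`. -/
theorem residualSpec_superset_image_jointResidualSpectrum
    {X : Type*} [NormedAddCommGroup X] [NormedSpace ℂ X] [CompleteSpace X]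
    {n : ℕ} (T : Fin n → ℝ → X →L[ℂ] X) (M : Fin n → ℝ)
    (hT : ∀ j, IsC0Semigroup (T j)) (hM : ∀ j t, 0 ≤ t → ‖T j t‖ ≤ M j)
    (hcomm : ∀ i j s t, 0 ≤ s → 0 ≤ t → T i s ∘L T j t = T j t ∘L T i s)
    (ψ : (Fin n → ℝ) → ℝ) (c₀ : ℝ) (c₁ : Fin n → ℝ) (μ : MeasureTheory.Measure (Fin n → ℝ))
    (hψ : MemTn n ψ) (hrep : HasLevyRep n ψ c₀ c₁ μ)
    (ν : ℝ → MeasureTheory.Measure (Fin n → ℝ)) (hν : IsSubordinator n ψ ν)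
    (g : ℝ → X →L[ℂ] X) (hgsem : IsC0Semigroup g)
    (hg : ∀ t, 0 ≤ t → ∀ x : X, g t x = ∫ u, Tprod T u x ∂(ν t)) :
    psiC n c₀ c₁ μ '' JointResidualSpectrum T
      ⊆ ResidualSpec (fun x y : X => InGenDomain g x y) := by
  rintro _ ⟨l, hl, rfl⟩
  obtain ⟨f, hf0, hf⟩ := aux_functional _ hl
  have heig : ∀ j (x : X) (h : ℝ), 0 ≤ h → f (T j h x) = Complex.exp (l j * h) * f x := by
    intro j x h hh
    refine aux_eigen (T j) (M j) (hT j) (hM j) f (l j) (fun x y hxy => ?_) x h hh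
    exact hf _ (Set.mem_iUnion.2 ⟨j, x, y, hxy, rfl⟩)
  obtain ⟨x₀, hx₀⟩ : ∃ x, f x ≠ 0 := by
    by_contra hcon
    push Not at hcon
    exact hf0 (ContinuousLinearMap.ext hcon)
  have hre : ∀ j, (l j).re ≤ 0 := fun j =>
    aux_re (T j) (M j) (hM j) f (l j) x₀ hx₀ (heig j x₀)
  set w := psiC n c₀ c₁ μ l with hw
  have hgt : ∀ t, 0 ≤ t → ∀ x, f (g t x) = Complex.exp (t * w) * f x := by
    intro t ht x
    obtain ⟨hfin, hsupp, hlap⟩ := hν t ht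
    have hsupp' : ∀ᵐ u ∂(ν t), ∀ j, 0 ≤ u j := hsupp
    have hms : MeasurableSet {u : Fin n → ℝ | ∀ j, 0 ≤ u j} := by
      rw [Set.ofPred_forall]
      exact MeasurableSet.iInter fun j => measurableSet_le measurable_const (measurable_pi_apply j)
    have hint : Integrable (fun u => Tprod T u x) (ν t) := by
      obtain ⟨C, hC⟩ := aux_Tprod_bd T M hM x
      refine (integrable_const C).mono' ?_ (hsupp'.mono fun u hu => hC u hu)
      have h1 := (aux_Tprod_cont T M hT hM x).aestronglyMeasurable (μ := ν t) hms
      rwa [Measure.restrict_eq_self_of_ae_mem (s := {u : Fin n → ℝ | ∀ j, 0 ≤ u j}) hsupp'] at h1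
    rw [hg t ht x, ← f.integral_comp_comm hint]
    rw [integral_congr_ae (hsupp'.mono fun u hu => aux_Tprod_eig T f l heig x u hu),
      integral_mul_const, aux_laplace ψ c₀ c₁ μ (ν t) hrep t hsupp hlap l hre]
  refine aux_not_dense _ f hf0 ?_
  rintro z ⟨x, y, hxy, rfl⟩
  have h1 : Tendsto (fun t : ℝ => f (t⁻¹ • (g t x - x))) (𝓝[>] 0) (𝓝 (f y)) :=
    (f.continuous.tendsto y).comp hxy
  have hd : HasDerivAt (fun t : ℝ => Complex.exp (t * w) * f x) (w * f x) 0 := by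
    have : HasDerivAt (fun t : ℂ => Complex.exp (t * w)) w ((0:ℝ) : ℂ) := by
      simpa using ((hasDerivAt_id ((0:ℝ) : ℂ)).mul_const w).cexp
    exact this.comp_ofReal.mul_const (f x)
  have h2 := (hasDerivAt_iff_tendsto_slope_zero.1 hd).mono_left
      (nhdsWithin_mono (0:ℝ) (s := Set.Ioi 0) (fun t (ht : 0 < t) => ht.ne'))
  have h3 : f y = w * f x := by
    refine tendsto_nhds_unique (h1.congr' ?_) h2
    filter_upwards [self_mem_nhdsWithin] with t ht
    have e : f (t⁻¹ • (g t x - x)) = t⁻¹ • (f (g t x) - f x) := by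
      rw [← map_sub]; exact (f.restrictScalars ℝ).map_smul _ _
    rw [e, hgt t (le_of_lt ht) x]
    simp
  rw [map_sub, map_smul, h3, smul_eq_mul, sub_self]
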